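/- arXiv:1901.06949 — 4 statements merged into one kernel-verified Lean document; each statement's English description precedes it below -/
import Mathlib

section
/- Let ε > 0, Δ > 0, and n ≥ 1, and let x, x' ∈ ℝⁿ satisfy ∑_{i=1}^n |x_i − x'_i| ≤ Δ. Then for every z ∈ ℝⁿ, the products of one-dimensional Laplace densities with scale λ = Δ/ε satisfy ∏_{i=1}^n (1/(2λ))·exp(−|z_i − x_i|/λ) ≤ exp(ε) · ∏_{i=1}^n (1/(2λ))·exp(−|z_i − x'_i|/λ). -/
open Real Finset

/-- product of one-dimensional Laplace densities (scale λ = Δ/ε)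
satisfies the pointwise ratio bound exp(ε) when the inputs are at ℓ1 distance
at most Δ. -/
theorem laplace_product_density_ratio_bound (n : ℕ) (hn : 1 ≤ n) (ε Δ : ℝ)
    (hε : 0 < ε) (hΔ : 0 < Δ) (x x' z : Fin n → ℝ)
    (h : ∑ i, |x i - x' i| ≤ Δ) :
    ∏ i, (1 / (2 * (Δ / ε))) * Real.exp (-|z i - x i| / (Δ / ε)) ≤
      Real.exp ε * ∏ i, (1 / (2 * (Δ / ε))) * Real.exp (-|z i - x' i| / (Δ / ε)) := by
  have hL : 0 < Δ / ε := div_pos hΔ hε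
  rw [Finset.prod_mul_distrib, Finset.prod_mul_distrib, ← Real.exp_sum, ← Real.exp_sum,
    mul_left_comm, ← Real.exp_add]
  have hc : 0 ≤ ∏ _i : Fin n, (1 / (2 * (Δ / ε))) :=
    Finset.prod_nonneg fun _ _ => by positivity
  refine mul_le_mul_of_nonneg_left (Real.exp_le_exp.mpr ?_) hc
  rw [← Finset.sum_div, ← Finset.sum_div, div_le_iff₀ hL, add_mul, div_mul_cancel₀ _ hL.ne']
  have e : ε * (Δ / ε) = Δ := by field_simp
  rw [e, Finset.sum_neg_distrib, Finset.sum_neg_distrib]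
  have key : ∑ i, |z i - x' i| ≤ ∑ i, |z i - x i| + ∑ i, |x i - x' i| := by
    rw [← Finset.sum_add_distrib]
    exact Finset.sum_le_sum fun i _ => abs_sub_le _ _ _
  linarith
end

section
/- Let ε > 0, Δ > 0, α > 0, and let Q : ℝⁿ → ℝ be a query such that |Q(D) − Q(D')| ≤ Δ for every pair of α-adjacent datasets D ∼_α D'. Define the Laplace mechanism 𝒜(D) to be the measure on ℝ given by Lebesgue measure with density z ↦ (ε/(2Δ))·exp(−ε·|z − Q(D)|/Δ). Then 𝒜 is ε-differentially private under α-indistinguishability: for all α-adjacent D ∼_α D' and every Lebesgue-measurable set O ⊆ ℝ, 𝒜(D)(O) ≤ exp(ε)·𝒜(D')(O). -/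
open Real MeasureTheory

/-- Two vectors are `α`-adjacent if they differ in at most one coordinate,
and there by at most `α`. -/
def Adjacent {ι : Type*} (α : ℝ) (D D' : ι → ℝ) : Prop :=
  ∃ i, |D i - D' i| ≤ α ∧ ∀ j, j ≠ i → D j = D' j

/-- The (one-dimensional) Laplace mechanism for a query `Q` with sensitivity
parameter `Δ` and privacy budget `ε`: Lebesgue measure with the Laplace density
of mean `Q D` and scale `Δ/ε`. -/
noncomputable def laplaceMech {n : ℕ} (ε Δ : ℝ) (Q : (Fin n → ℝ) → ℝ)
    (D : Fin n → ℝ) : Measure ℝ :=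
  volume.withDensity
    (fun z => ENNReal.ofReal ((ε / (2 * Δ)) * Real.exp (-(ε * |z - Q D|) / Δ)))

/-- the Laplace mechanism for a query of sensitivity `Δ` is
`ε`-differentially private under `α`-indistinguishability. -/
theorem laplaceMech_dp {n : ℕ} (ε Δ α : ℝ) (hε : 0 < ε) (hΔ : 0 < Δ) (hα : 0 < α)
    (Q : (Fin n → ℝ) → ℝ)
    (hQ : ∀ D D' : Fin n → ℝ, Adjacent α D D' → |Q D - Q D'| ≤ Δ)
    (D D' : Fin n → ℝ) (hDD' : Adjacent α D D')
    (O : Set ℝ) (hO : MeasurableSet O) :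
    laplaceMech ε Δ Q D O ≤ ENNReal.ofReal (Real.exp ε) * laplaceMech ε Δ Q D' O := by
  have hq := hQ D D' hDD'
  unfold laplaceMech
  rw [withDensity_apply _ hO, withDensity_apply _ hO,
    ← lintegral_const_mul' _ _ ENNReal.ofReal_ne_top]
  refine lintegral_mono fun z => ?_
  rw [← ENNReal.ofReal_mul (Real.exp_pos ε).le]
  apply ENNReal.ofReal_le_ofReal
  rw [mul_left_comm, ← Real.exp_add]
  refine mul_le_mul_of_nonneg_left (Real.exp_le_exp.mpr ?_) (by positivity)
  have h1 : |z - Q D'| ≤ |z - Q D| + Δ :=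
    (abs_sub_le z (Q D) (Q D')).trans (by linarith)
  have h2 : ε + -(ε * |z - Q D'|) / Δ = (ε * Δ - ε * |z - Q D'|) / Δ := by
    field_simp
    ring
  rw [h2]
  apply div_le_div_of_nonneg_right _ hΔ.le
  nlinarith
end

section
/- Let ε > 0 and α > 0. Define the n-dimensional Laplace mechanism for the identity query by 𝒜(D) = the measure on ℝⁿ given by n-dimensional Lebesgue measure with density z ↦ ∏_{i=1}^n (ε/(2α))·exp(−ε·|z_i − D_i|/α). Then 𝒜 is ε-differentially private under α-indistinguishability: for all α-adjacent D ∼_α D' in ℝⁿ and every Lebesgue-measurable set O ⊆ ℝⁿ, 𝒜(D)(O) ≤ exp(ε)·𝒜(D')(O). -/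
open Real MeasureTheory Finset

/-- The `n`-dimensional Laplace mechanism for the identity query: Lebesgue
measure on ℝⁿ with density the product of one-dimensional Laplace densities of
mean `D i` and scale `α/ε`. -/
noncomputable def lapIdMech (n : ℕ) (ε α : ℝ) (D : Fin n → ℝ) :
    Measure (Fin n → ℝ) :=
  volume.withDensity
    (fun z => ENNReal.ofReal (∏ i, (ε / (2 * α)) * Real.exp (-(ε * |z i - D i|) / α)))

/-- the `n`-dimensional Laplace mechanism for the identity query
is `ε`-differentially private under `α`-indistinguishability. -/
theorem lapIdMech_dp (n : ℕ) (ε α : ℝ) (hε : 0 < ε) (hα : 0 < α)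
    (D D' : Fin n → ℝ) (hDD' : Adjacent α D D')
    (O : Set (Fin n → ℝ)) (hO : MeasurableSet O) :
    lapIdMech n ε α D O ≤ ENNReal.ofReal (Real.exp ε) * lapIdMech n ε α D' O := by
  unfold lapIdMech
  rw [withDensity_apply _ hO, withDensity_apply _ hO,
    ← lintegral_const_mul' _ _ ENNReal.ofReal_ne_top]
  apply lintegral_mono
  intro z
  dsimp only
  rw [← ENNReal.ofReal_mul (Real.exp_pos ε).le]
  apply ENNReal.ofReal_le_ofReal
  obtain ⟨i, hi, hj⟩ := hDD'
  rw [← Finset.mul_prod_erase univ _ (Finset.mem_univ i),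
    ← Finset.mul_prod_erase univ
      (fun i => (ε / (2 * α)) * Real.exp (-(ε * |z i - D' i|) / α)) (Finset.mem_univ i),
    ← mul_assoc]
  have h1 : ∏ x ∈ univ.erase i, (ε / (2 * α)) * Real.exp (-(ε * |z x - D x|) / α)
      = ∏ x ∈ univ.erase i, (ε / (2 * α)) * Real.exp (-(ε * |z x - D' x|) / α) := by
    apply Finset.prod_congr rfl
    intro x hx
    rw [hj x (Finset.ne_of_mem_erase hx)]
  rw [h1]
  apply mul_le_mul_of_nonneg_right _ (Finset.prod_nonneg fun x _ => by positivity)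
  rw [mul_left_comm, ← Real.exp_add]
  apply mul_le_mul_of_nonneg_left _ (by positivity)
  apply Real.exp_le_exp.mpr
  have h2 : |z i - D' i| ≤ |z i - D i| + α :=
    (abs_sub_le (z i) (D i) (D' i)).trans (by linarith)
  have h3 : ε + -(ε * |z i - D' i|) / α = (ε * α - ε * |z i - D' i|) / α := by
    field_simp
    ring
  rw [h3]
  apply div_le_div_of_nonneg_right _ hα.le
  nlinarith [mul_le_mul_of_nonneg_left h2 hε.le]
end

section
/- Sequential composition of two mechanisms: let 𝒜₁ : ℝⁿ → Measure(Ω₁) and 𝒜₂ : ℝⁿ → Measure(Ω₂) assign to each dataset an s-finite measure, and suppose 𝒜₁ is ε₁-differentially private and 𝒜₂ is ε₂-differentially private under α-indistinguishability. Then the mechanism D ↦ (𝒜₁(D)) × (𝒜₂(D)), which releases the two outputs independently via the product measure, is (ε₁ + ε₂)-differentially private under α-indistinguishability: for all α-adjacent D ∼_α D' and every measurable O ⊆ Ω₁ × Ω₂, (𝒜₁(D) × 𝒜₂(D))(O) ≤ exp(ε₁ + ε₂)·(𝒜₁(D') × 𝒜₂(D'))(O). -/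
open Real MeasureTheory

/-- A mechanism is `ε`-differentially private under `α`-indistinguishability. -/
def IsDP {ι : Type*} {Ω : Type*} [MeasurableSpace Ω] (ε α : ℝ)
    (A : (ι → ℝ) → Measure Ω) : Prop :=
  ∀ D D' : ι → ℝ, Adjacent α D D' → ∀ O : Set Ω, MeasurableSet O →
    A D O ≤ ENNReal.ofReal (Real.exp ε) * A D' O

/-- sequential composition of two mechanisms via the product
measure is `(ε₁ + ε₂)`-differentially private. -/
theorem sequential_composition {n : ℕ} {Ω₁ Ω₂ : Type*}
    [MeasurableSpace Ω₁] [MeasurableSpace Ω₂] (ε₁ ε₂ α : ℝ)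
    (A₁ : (Fin n → ℝ) → Measure Ω₁) (A₂ : (Fin n → ℝ) → Measure Ω₂)
    [∀ D, SFinite (A₁ D)] [∀ D, SFinite (A₂ D)]
    (h₁ : IsDP ε₁ α A₁) (h₂ : IsDP ε₂ α A₂) :
    IsDP (ε₁ + ε₂) α (fun D => (A₁ D).prod (A₂ D)) := by
  intro D D' hD O hO
  have hle : A₁ D ≤ ENNReal.ofReal (Real.exp ε₁) • A₁ D' := by
    refine Measure.le_iff.2 fun s hs => ?_
    simpa using h₁ D D' hD s hs
  show (A₁ D).prod (A₂ D) O ≤ ENNReal.ofReal (Real.exp (ε₁ + ε₂)) * (A₁ D').prod (A₂ D') O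
  rw [Measure.prod_apply hO, Measure.prod_apply hO]
  calc ∫⁻ x, A₂ D (Prod.mk x ⁻¹' O) ∂(A₁ D)
      ≤ ∫⁻ x, ENNReal.ofReal (Real.exp ε₂) * A₂ D' (Prod.mk x ⁻¹' O)
          ∂(ENNReal.ofReal (Real.exp ε₁) • A₁ D') :=
        lintegral_mono' hle fun x => h₂ D D' hD _ (measurable_prodMk_left hO)
    _ = ENNReal.ofReal (Real.exp (ε₁ + ε₂)) * ∫⁻ x, A₂ D' (Prod.mk x ⁻¹' O) ∂(A₁ D') := by
        rw [lintegral_smul_measure, lintegral_const_mul _ (measurable_measure_prodMk_left hO),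
          Real.exp_add, ENNReal.ofReal_mul (Real.exp_pos _).le, smul_eq_mul, mul_assoc]
end
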